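/- Existence of φ-sets: Let e₀ = (0,0), e₁, e₂, ... be distinct points of ℝ² and write S_n = {e₀, ..., e_{n−1}}. For all integers n ≥ 2 and k ≥ 1, there exists a finite set Y ⊆ ℝ² such that for every coloring f of Y with k colors there exist a ∈ ℝ² and λ > 0 with a + λ • S_n ⊆ Y and f constant on a + λ • S_n; that is, Y contains a monochromatic homothetic image of S_n under any k-coloring. -/

import Mathlib

/-- `S_n = {e₀, …, e_{n−1}}`. -/
def Sset (e : ℕ → ℝ × ℝ) (n : ℕ) : Set (ℝ × ℝ) := e '' {i | i < n}

/-- The homothetic image `a + l • X`. -/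
def homImage (a : ℝ × ℝ) (l : ℝ) (X : Set (ℝ × ℝ)) : Set (ℝ × ℝ) :=
  (fun x => a + l • x) '' X

/-- Existence of φ-sets: for all `n ≥ 2` and `k ≥ 1` there is a finite set `Y ⊆ ℝ²` that,
under any `k`-coloring, contains a monochromatic homothetic image of `S_n`. -/
theorem gallai_phi_exists (e : ℕ → ℝ × ℝ) (he0 : e 0 = 0)
    (hinj : Function.Injective e) (n k : ℕ) (hn : 2 ≤ n) (hk : 1 ≤ k) :
    ∃ Y : Set (ℝ × ℝ), Y.Finite ∧
      ∀ f : ℝ × ℝ → Fin k, ∃ (a : ℝ × ℝ) (l : ℝ), 0 < l ∧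
        homImage a l (Sset e n) ⊆ Y ∧
        ∀ x ∈ Sset e n, ∀ y ∈ Sset e n, f (a + l • x) = f (a + l • y) := by
  classical
  obtain ⟨ι, _inst, hι⟩ := Combinatorics.Line.exists_mono_in_high_dimension (Fin n) (Fin k)
  refine ⟨Set.range (fun v : ι → Fin n => ∑ i, e (v i)), Set.finite_range _, fun f => ?_⟩
  obtain ⟨L, c, hL⟩ := hι (fun v => f (∑ i, e (v i)))
  have key : ∀ x : Fin n, (∑ i, (L.idxFun i).elim 0 (fun j => e j)) +
      (∑ i, (L.idxFun i).elim (1 : ℝ) (fun _ => 0)) • e x = ∑ i, e (L x i) := by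
    intro x
    rw [Finset.sum_smul, ← Finset.sum_add_distrib]
    refine Finset.sum_congr rfl fun i _ => ?_
    rw [Combinatorics.Line.apply_def]
    cases h : L.idxFun i <;> simp [h]
  refine ⟨∑ i, (L.idxFun i).elim 0 (fun j => e j),
    ∑ i, (L.idxFun i).elim (1 : ℝ) (fun _ => 0), ?_, ?_, ?_⟩
  · obtain ⟨i, hi⟩ := L.proper
    refine Finset.sum_pos' (fun j _ => ?_) ⟨i, Finset.mem_univ _, ?_⟩
    · cases L.idxFun j <;> simp
    · simp [hi]
  · rintro _ ⟨_, ⟨i, hi, rfl⟩, rfl⟩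
    exact ⟨L ⟨i, hi⟩, (key ⟨i, hi⟩).symm⟩
  · rintro _ ⟨i, hi, rfl⟩ _ ⟨j, hj, rfl⟩
    have h1 := key ⟨i, hi⟩
    have h2 := key ⟨j, hj⟩
    simp only at h1 h2
    rw [h1, h2]
    exact (hL ⟨i, hi⟩).trans (hL ⟨j, hj⟩).symm
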